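/- arXiv:2308.15277 — 3 statements merged into one kernel-verified Lean document; each statement's English description precedes it below -/
import Mathlib

section
/- Let E be a nontrivial real Banach space, let ω : [0,∞) → [0,∞) be concave, nondecreasing, not identically zero, with ω(0) = 0, and fix x₀ ∈ E. Then for every f ∈ 𝒞_ω(E), every s > 0, every μ ∈ (0,1), every ε > 0 and every R > 0, there exist h ∈ 𝒞_ω(E) and points y₀, z₀ ∈ E such that ‖y₀ − z₀‖ = s, ‖h(y₀) − h(z₀)‖ ≥ (1 − μ/2)·ω(s), and ‖f(x) − h(x)‖ ≤ ε for every x with ‖x − x₀‖ ≤ R. -/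
open Set

/-- A concave function on `[0, ∞)` vanishing at `0` is star-shaped. -/
lemma ConcaveOn.mul_le_map_mul {ω : ℝ → ℝ} (hconc : ConcaveOn ℝ (Ici 0) ω) (h0 : ω 0 = 0)
    {a t : ℝ} (ha : 0 ≤ a) (ha1 : a ≤ 1) (ht : 0 ≤ t) : a * ω t ≤ ω (a * t) := by
  have h := hconc.2 (mem_Ici.2 ht) (mem_Ici.2 le_rfl) ha (sub_nonneg.2 ha1) (by ring)
  simpa [h0] using h

lemma ConcaveOn.mul_map_le_mul_map {ω : ℝ → ℝ} (hconc : ConcaveOn ℝ (Ici 0) ω) (h0 : ω 0 = 0)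
    {t T : ℝ} (ht : 0 ≤ t) (htT : t ≤ T) (hT : 0 < T) : t * ω T ≤ T * ω t := by
  have h := hconc.mul_le_map_mul h0 (div_nonneg ht hT.le) ((div_le_one hT).2 htT) hT.le
  rw [div_mul_cancel₀ _ hT.ne', div_mul_eq_mul_div, div_le_iff₀ hT] at h
  linarith

lemma ConcaveOn.map_add_le_add {ω : ℝ → ℝ} (hconc : ConcaveOn ℝ (Ici 0) ω) (h0 : ω 0 = 0)
    {a b : ℝ} (ha : 0 ≤ a) (hb : 0 ≤ b) : ω (a + b) ≤ ω a + ω b := by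
  rcases (add_nonneg ha hb).eq_or_lt with h | h
  · have ha0 : a = 0 := by linarith
    have hb0 : b = 0 := by linarith
    simp [ha0, hb0, h0]
  · have h1 := hconc.mul_map_le_mul_map h0 ha (le_add_of_nonneg_right hb) h
    have h2 := hconc.mul_map_le_mul_map h0 hb (le_add_of_nonneg_left ha) h
    nlinarith

lemma ConcaveOn.abs_map_sub_map_le {ω : ℝ → ℝ} (hconc : ConcaveOn ℝ (Ici 0) ω)
    (hmono : MonotoneOn ω (Ici 0)) (h0 : ω 0 = 0)
    {a b : ℝ} (ha : 0 ≤ a) (hb : 0 ≤ b) : |ω a - ω b| ≤ ω |a - b| := by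
  wlog hab : b ≤ a generalizing a b
  · rw [abs_sub_comm, abs_sub_comm a]
    exact this hb ha (le_of_not_ge hab)
  rw [abs_of_nonneg (sub_nonneg.2 hab),
    abs_of_nonneg (sub_nonneg.2 (hmono (mem_Ici.2 hb) (mem_Ici.2 ha) hab))]
  have := hconc.map_add_le_add h0 (sub_nonneg.2 hab) hb
  rw [sub_add_cancel] at this
  linarith

/-- Dilating the argument of a concave modulus enlarges its value by at most the same factor. -/
lemma ConcaveOn.map_one_add_mul_le {ω : ℝ → ℝ} (hconc : ConcaveOn ℝ (Ici 0) ω) (h0 : ω 0 = 0)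
    {δ t : ℝ} (hδ : 0 ≤ δ) (ht : 0 ≤ t) : ω ((1 + δ) * t) ≤ (1 + δ) * ω t := by
  rcases ht.eq_or_lt with rfl | ht
  · simp [h0]
  have h := hconc.mul_map_le_mul_map h0 ht.le (T := (1 + δ) * t) (by nlinarith) (by positivity)
  rw [show (1 + δ) * t * ω t = t * ((1 + δ) * ω t) by ring] at h
  exact le_of_mul_le_mul_left h ht

/-- In any normed space there are almost nonexpansive maps that fix a given ball pointwise and
vanish off a larger ball. -/
lemma exists_almost_nonexpansive_cutoff (E : Type*) [NormedAddCommGroup E] [NormedSpace ℝ E]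
    {δ R : ℝ} (hδ : 0 < δ) (hR : 0 < R) :
    ∃ (r : E → E) (B : ℝ), R ≤ B ∧ (∀ x y, ‖r x - r y‖ ≤ (1 + δ) * ‖x - y‖) ∧
      (∀ x, ‖x‖ ≤ R → r x = x) ∧ (∀ x, B ≤ ‖x‖ → r x = 0) ∧ ∀ x, ‖r x‖ ≤ B := by
  set ρ : ℝ → ℝ := fun t ↦ max 0 (1 - δ * Real.log (max t R / R)) with hρ
  have hlog0 : ∀ t, 0 ≤ Real.log (max t R / R) := fun t ↦
    Real.log_nonneg ((one_le_div hR).2 (le_max_right _ _))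
  have hρ0 : ∀ t, 0 ≤ ρ t := fun t ↦ le_max_left _ _
  have hρ1 : ∀ t, ρ t ≤ 1 := fun t ↦
    max_le zero_le_one (by nlinarith [hlog0 t])
  have hρB : ∀ t, R * Real.exp (1 / δ) ≤ t → ρ t = 0 := by
    intro t ht
    refine max_eq_left ?_
    have h1 : Real.exp (1 / δ) ≤ max t R / R := by
      rw [le_div_iff₀ hR, mul_comm]
      exact ht.trans (le_max_left _ _)
    have h2 : 1 / δ ≤ Real.log (max t R / R) :=
      (Real.le_log_iff_exp_le ((Real.exp_pos _).trans_le h1)).2 h1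
    rw [div_le_iff₀ hδ] at h2
    linarith
  have hvar : ∀ a b, 0 ≤ a → a ≤ b → |ρ a - ρ b| * a ≤ δ * (b - a) := by
    intro a b ha hab
    set u := max a R
    set v := max b R
    have hu : 0 < u := hR.trans_le (le_max_right _ _)
    have hv : 0 < v := hR.trans_le (le_max_right _ _)
    have huv : v - u ≤ b - a := by
      have h := abs_max_sub_max_le_abs b a R
      rw [abs_of_nonneg (sub_nonneg.2 hab)] at h
      exact (le_abs_self _).trans h
    have huv0 : u ≤ v := max_le_max_right R hab
    have hdiff : |ρ a - ρ b| ≤ δ * Real.log (v / u) := by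
      have h := abs_max_sub_max_le_abs (1 - δ * Real.log (u / R)) (1 - δ * Real.log (v / R)) 0
      rw [max_comm _ (0 : ℝ), max_comm _ (0 : ℝ)] at h
      refine h.trans ?_
      rw [Real.log_div hu.ne' hR.ne', Real.log_div hv.ne' hR.ne', Real.log_div hv.ne' hu.ne']
      have := Real.log_le_log hu huv0
      rw [abs_of_nonneg (by nlinarith)]
      nlinarith
    have hlog : Real.log (v / u) * u ≤ v - u := by
      have h := Real.log_le_sub_one_of_pos (div_pos hv hu)
      calc Real.log (v / u) * u ≤ (v / u - 1) * u := by gcongr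
        _ = v - u := by field_simp
    calc |ρ a - ρ b| * a ≤ |ρ a - ρ b| * u := by gcongr; exact le_max_left _ _
      _ ≤ δ * Real.log (v / u) * u := by gcongr
      _ = δ * (Real.log (v / u) * u) := by ring
      _ ≤ δ * (b - a) := by gcongr; exact hlog.trans huv
  have hlip : ∀ x y : E, ‖ρ ‖x‖ • x - ρ ‖y‖ • y‖ ≤ (1 + δ) * ‖x - y‖ := by
    intro x y
    wlog hxy : ‖x‖ ≤ ‖y‖ generalizing x y
    · rw [norm_sub_rev, norm_sub_rev x]
      exact this y x (le_of_not_ge hxy)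
    have e : ρ ‖x‖ • x - ρ ‖y‖ • y = (ρ ‖x‖ - ρ ‖y‖) • x + ρ ‖y‖ • (x - y) := by module
    rw [e]
    refine (norm_add_le _ _).trans ?_
    rw [norm_smul, norm_smul, Real.norm_eq_abs, Real.norm_of_nonneg (hρ0 _)]
    have h1 := hvar ‖x‖ ‖y‖ (norm_nonneg _) hxy
    have h2 : ‖y‖ - ‖x‖ ≤ ‖x - y‖ := by
      rw [norm_sub_rev]; exact norm_sub_norm_le _ _
    have h3 : ρ ‖y‖ * ‖x - y‖ ≤ 1 * ‖x - y‖ := by gcongr; exact hρ1 _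
    nlinarith
  have hRB : R ≤ R * Real.exp (1 / δ) :=
    le_mul_of_one_le_right hR.le (Real.one_le_exp (by positivity))
  refine ⟨fun x ↦ ρ ‖x‖ • x, R * Real.exp (1 / δ), hRB, hlip, fun x hx ↦ ?_, fun x hx ↦ ?_,
    fun x ↦ ?_⟩
  · simp [hρ, max_eq_right hx, hR.ne']
  · simp [hρB _ hx]
  · rcases le_total (R * Real.exp (1 / δ)) ‖x‖ with h | h
    · simp only [hρB _ h, zero_smul, norm_zero]
      exact hR.le.trans hRB
    · rw [norm_smul, Real.norm_of_nonneg (hρ0 _)]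
      exact (mul_le_of_le_one_left (norm_nonneg _) (hρ1 _)).trans h

/-- A set of diameter at most `M` can be extended by one point, keeping the diameter at most `M`,
so that this point is at distance almost `M` from some point of the set. -/
lemma exists_almost_diametral_point {E : Type*} [NormedAddCommGroup E] [NormedSpace ℝ E]
    [Nontrivial E] {D : Set E} {M η : ℝ} (hD : D.Nonempty) (hM : 0 < M) (hη : 0 < η)
    (hdiam : ∀ x ∈ D, ∀ y ∈ D, ‖x - y‖ ≤ M) :
    ∃ q, (∀ x ∈ D, ‖q - x‖ ≤ M) ∧ ∃ p ∈ D, (1 - η) * M ≤ ‖q - p‖ := by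
  obtain ⟨c, hc⟩ := hD
  obtain ⟨e, he⟩ := exists_norm_eq E zero_le_one
  set S : Set ℝ := {t | 0 ≤ t ∧ ∀ x ∈ D, ‖c + t • e - x‖ ≤ M} with hS
  have hSne : S.Nonempty := ⟨0, le_rfl, fun x hx ↦ by simpa using hdiam c hc x hx⟩
  have hSbdd : BddAbove S := by
    refine ⟨M, fun t ht ↦ ?_⟩
    have := ht.2 c hc
    rwa [add_sub_cancel_left, norm_smul, he, mul_one, Real.norm_of_nonneg ht.1] at this
  have hηM : 0 < η * M := mul_pos hη hM
  obtain ⟨t, htS, ht⟩ := exists_lt_of_lt_csSup hSne (sub_lt_self (sSup S) hηM)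
  have hnot : t + η * M ∉ S := fun h ↦ by
    linarith [le_csSup hSbdd h]
  have hex : ∃ x ∈ D, M < ‖c + (t + η * M) • e - x‖ := by
    by_contra! hcon
    exact hnot ⟨add_nonneg htS.1 hηM.le, hcon⟩
  obtain ⟨p, hp, hMp⟩ := hex
  refine ⟨c + t • e, htS.2, p, hp, ?_⟩
  have e1 : c + (t + η * M) • e - p = (c + t • e - p) + (η * M) • e := by module
  have h2 := norm_add_le (c + t • e - p) ((η * M) • e)
  rw [← e1, norm_smul, he, mul_one, Real.norm_of_nonneg hηM.le] at h2
  linarith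

/-- Step 1 of the main theorem (normed-space instance): every `f ∈ 𝒞_ω(E)` can be
approximated, uniformly on any given ball around `x₀`, by a map `h ∈ 𝒞_ω(E)` which
realises the value `(1 - μ/2) ω s` of the modulus of continuity at some pair of points
at distance exactly `s`. -/
theorem stmt_2 {E : Type*} [NormedAddCommGroup E] [NormedSpace ℝ E]
    [CompleteSpace E] [Nontrivial E]
    (ω : ℝ → ℝ) (hnonneg : ∀ s, 0 ≤ s → 0 ≤ ω s)
    (hconc : ConcaveOn ℝ (Ici 0) ω) (hmono : MonotoneOn ω (Ici 0))
    (h0 : ω 0 = 0) (hne : ∃ s, 0 < s ∧ ω s ≠ 0)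
    (x₀ : E) (f : E → E) (hf : ∀ x y : E, ‖f x - f y‖ ≤ ω ‖x - y‖)
    (s : ℝ) (hs : 0 < s) (μ : ℝ) (hμ : μ ∈ Ioo (0 : ℝ) 1)
    (ε : ℝ) (hε : 0 < ε) (R : ℝ) (hR : 0 < R) :
    ∃ h : E → E, (∀ x y : E, ‖h x - h y‖ ≤ ω ‖x - y‖) ∧
      ∃ y₀ z₀ : E, ‖y₀ - z₀‖ = s ∧ (1 - μ / 2) * ω s ≤ ‖h y₀ - h z₀‖ ∧
        ∀ x : E, ‖x - x₀‖ ≤ R → ‖f x - h x‖ ≤ ε := by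
  obtain ⟨hμ0, hμ1⟩ := hμ
  have hωs : 0 < ω s := by
    obtain ⟨t, ht, hωt⟩ := hne
    have hpos : 0 < ω t := (hnonneg t ht.le).lt_of_ne' hωt
    rcases le_total t s with h | h
    · exact hpos.trans_le (hmono ht.le hs.le h)
    · have := hconc.mul_map_le_mul_map h0 hs.le h ht
      exact pos_of_mul_pos_right ((mul_pos hs hpos).trans_le this) ht.le
  obtain ⟨l, hl0, hlμ, hlε⟩ : ∃ l : ℝ, 0 < l ∧ l ≤ μ / 4 ∧ l * ω R ≤ ε := by
    have hωR := hnonneg R hR.le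
    refine ⟨min (μ / 4) (ε / (ω R + 1)), by positivity, min_le_left _ _, ?_⟩
    calc min (μ / 4) (ε / (ω R + 1)) * ω R ≤ ε / (ω R + 1) * (ω R + 1) := by
          gcongr
          · exact min_le_right _ _
          · linarith
      _ = ε := by field_simp
  obtain ⟨r, B, hRB, hrlip, hrid, hr0, hrB⟩ := exists_almost_nonexpansive_cutoff E hl0 hR
  set f₁ : E → E := fun x ↦ f (x₀ + r (x - x₀)) with hf₁
  have hf₁far : ∀ x, B ≤ ‖x - x₀‖ → f₁ x = f x₀ := fun x hx ↦ by simp [hf₁, hr0 _ hx]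
  have hf₁near : ∀ x, ‖x - x₀‖ ≤ R → f₁ x = f x := fun x hx ↦ by simp [hf₁, hrid _ hx]
  set T : ℝ := max (2 * B) s with hTdef
  have hT : 0 < T := hs.trans_le (le_max_right _ _)
  set M : ℝ := ω T with hMdef
  have hsM : ω s ≤ M := hmono hs.le hT.le (le_max_right _ _)
  have hM : 0 < M := hωs.trans_le hsM
  have hf₁diam : ∀ x ∈ range f₁, ∀ y ∈ range f₁, ‖x - y‖ ≤ M := by
    rintro _ ⟨x, rfl⟩ _ ⟨y, rfl⟩
    refine (hf _ _).trans (hmono (norm_nonneg _) hT.le ?_)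
    rw [add_sub_add_left_eq_sub]
    refine (norm_sub_le _ _).trans (le_trans ?_ (le_max_left _ _))
    linarith [hrB (x - x₀), hrB (y - x₀)]
  have hf₁mod : ∀ x y, ‖f₁ x - f₁ y‖ ≤ (1 + l) * ω ‖x - y‖ := by
    intro x y
    refine (hf _ _).trans (le_trans ?_ (hconc.map_one_add_mul_le h0 hl0.le (norm_nonneg _)))
    refine hmono (norm_nonneg _) (mem_Ici.2 (by positivity)) ?_
    rw [add_sub_add_left_eq_sub]
    simpa using hrlip (x - x₀) (y - x₀)
  obtain ⟨q, hqM, p, hpD, hpq⟩ :=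
    exists_almost_diametral_point ⟨_, mem_range_self x₀⟩ hM hl0 hf₁diam
  obtain ⟨e, he⟩ := exists_norm_eq E zero_le_one
  set L : ℝ := T / l with hL
  have hL0 : 0 < L := by positivity
  set c := f x₀ with hc
  set y₀ : E := x₀ + (B + T + s + L) • e with hy₀
  have hy₀x₀ : ‖y₀ - x₀‖ = B + T + s + L := by
    rw [hy₀, add_sub_cancel_left, norm_smul, he, mul_one, Real.norm_of_nonneg (by linarith)]
  have hcD : c ∈ range f₁ := ⟨y₀, hf₁far _ (by linarith)⟩
  set θ : E → ℝ := fun x ↦ max 0 (1 - max (‖x - y₀‖ - s) 0 / L) with hθ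
  set φ : E → ℝ := fun x ↦ (ω s - ω (min ‖x - y₀‖ s)) / M with hφ
  have hθ0 : ∀ x, 0 ≤ θ x := fun x ↦ le_max_left _ _
  have hθ1 : ∀ x, θ x ≤ 1 := fun x ↦ max_le zero_le_one (sub_le_self _ (by positivity))
  have hθin : ∀ x, ‖x - y₀‖ ≤ s → θ x = 1 := fun x hx ↦ by
    simp [hθ, max_eq_right (sub_nonpos.2 hx)]
  have hθout : ∀ x, s + L ≤ ‖x - y₀‖ → θ x = 0 := fun x hx ↦ by
    refine max_eq_left (sub_nonpos.2 ((one_le_div hL0).2 ?_))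
    exact le_max_of_le_left (by linarith)
  have hmin0 : ∀ x, 0 ≤ min ‖x - y₀‖ s := fun x ↦ le_min (norm_nonneg _) hs.le
  have hφ0 : ∀ x, 0 ≤ φ x := fun x ↦
    div_nonneg (sub_nonneg.2 (hmono (hmin0 x) hs.le (min_le_right _ _))) hM.le
  have hφ1 : ∀ x, φ x ≤ 1 := fun x ↦
    (div_le_one hM).2 (by linarith [hnonneg _ (hmin0 x)])
  have hφout : ∀ x, s ≤ ‖x - y₀‖ → φ x = 0 := fun x hx ↦ by simp [hφ, min_eq_right hx]
  have hφθ : ∀ x, φ x ≤ θ x := by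
    intro x
    rcases le_total ‖x - y₀‖ s with h | h
    · exact (hφ1 x).trans_eq (hθin x h).symm
    · exact (hφout x h).trans_le (hθ0 x)
  have hnorm : ∀ x y : E, |‖x - y₀‖ - ‖y - y₀‖| ≤ ‖x - y‖ := fun x y ↦ by
    simpa using abs_norm_sub_norm_le (x - y₀) (y - y₀)
  have hθlip : ∀ x y, |θ x - θ y| ≤ ‖x - y‖ / L := by
    intro x y
    have h1 := abs_max_sub_max_le_abs (1 - max (‖x - y₀‖ - s) 0 / L)
      (1 - max (‖y - y₀‖ - s) 0 / L) 0
    have h2 := abs_max_sub_max_le_abs (‖x - y₀‖ - s) (‖y - y₀‖ - s) 0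
    rw [max_comm _ (0 : ℝ), max_comm (1 - max (‖y - y₀‖ - s) 0 / L) (0 : ℝ)] at h1
    refine h1.trans ?_
    rw [sub_sub_sub_cancel_left, ← sub_div, abs_div, abs_of_pos hL0, abs_sub_comm]
    gcongr
    refine h2.trans ?_
    rw [sub_sub_sub_cancel_right]
    exact hnorm x y
  have hφmod : ∀ x y, |φ x - φ y| * M ≤ ω ‖x - y‖ := by
    intro x y
    rw [hφ]
    dsimp only
    rw [← sub_div, abs_div, abs_of_pos hM, div_mul_cancel₀ _ hM.ne', sub_sub_sub_cancel_left,
      abs_sub_comm]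
    refine (hconc.abs_map_sub_map_le hmono h0 (hmin0 x) (hmin0 y)).trans ?_
    refine hmono (mem_Ici.2 (abs_nonneg _)) (norm_nonneg _) ?_
    refine (abs_min_sub_min_le_max _ _ _ _).trans ?_
    rw [sub_self, abs_zero, max_eq_left (abs_nonneg _)]
    exact hnorm x y
  set H : E → E := fun x ↦ f₁ x + (θ x • (p - c) + φ x • (q - p)) with hH
  have hsep : ∀ x y, ‖x - x₀‖ < B → ‖x - y‖ < T → s + L ≤ ‖y - y₀‖ := by
    intro x y hx hxy
    have h1 : ‖y₀ - x₀‖ ≤ ‖y - y₀‖ + ‖x - y‖ + ‖x - x₀‖ := by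
      rw [show y₀ - x₀ = -(y - y₀) - (x - y) + (x - x₀) by abel]
      refine (norm_add_le _ _).trans ?_
      gcongr
      refine (norm_sub_le _ _).trans ?_
      rw [norm_neg]
    linarith
  have hHfar : ∀ x, s + L ≤ ‖x - y₀‖ → H x = f₁ x := fun x hx ↦ by
    simp [hH, hθout x hx, hφout x (by linarith)]
  have hHhull : ∀ x, H x ∈ convexHull ℝ (insert q (range f₁)) := by
    intro x
    have hsub := subset_convexHull ℝ (insert q (range f₁))
    rcases lt_or_ge ‖x - x₀‖ B with hx | hx
    · rw [hHfar x (hsep x x hx (by simpa using hT))]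
      exact hsub (mem_insert_of_mem _ (mem_range_self x))
    · have e1 : H x = (1 - θ x) • c + (θ x - φ x) • p + φ x • q := by
        simp only [hH, hf₁far x hx]
        module
      rw [e1]
      have h3 := (convex_convexHull ℝ (insert q (range f₁))).sum_mem (t := Finset.univ)
        (w := ![1 - θ x, θ x - φ x, φ x]) (z := ![c, p, q]) ?_ ?_ ?_
      · simpa [Fin.sum_univ_three] using h3
      · simp [Fin.forall_fin_succ, hθ1 x, hφθ x, hφ0 x]
      · simp [Fin.sum_univ_three]
      · simp only [Finset.mem_univ, forall_const, Fin.forall_fin_succ]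
        exact ⟨hsub (mem_insert_of_mem _ hcD), hsub (mem_insert_of_mem _ hpD),
          hsub (mem_insert _ _), fun i ↦ i.elim0⟩
  have hHdiam : ∀ x y, ‖H x - H y‖ ≤ M := by
    intro x y
    obtain ⟨a, ha, b, hb, hab⟩ := convexHull_exists_dist_ge2 (hHhull x) (hHhull y)
    rw [dist_eq_norm, dist_eq_norm] at hab
    refine hab.trans ?_
    rcases ha with rfl | ha <;> rcases hb with rfl | hb
    · simpa using hM.le
    · exact hqM b hb
    · rw [norm_sub_rev]; exact hqM a ha
    · exact hf₁diam a ha b hb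
  have hl1 : 0 ≤ 1 - l := by linarith
  have hHmod : ∀ x y, (1 - l) * ‖H x - H y‖ ≤ ω ‖x - y‖ := by
    intro x y
    have hω0 := hnonneg ‖x - y‖ (norm_nonneg _)
    rcases le_or_gt T ‖x - y‖ with hxy | hxy
    · have h1 : M ≤ ω ‖x - y‖ := hmono hT.le (norm_nonneg _) hxy
      nlinarith [hHdiam x y]
    by_cases hfar : B ≤ ‖x - x₀‖ ∧ B ≤ ‖y - x₀‖
    · have e1 : H x - H y = (θ x - θ y) • (p - c) + (φ x - φ y) • (q - p) := by
        simp only [hH, hf₁far x hfar.1, hf₁far y hfar.2]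
        module
      have h1 : ‖H x - H y‖ ≤ ‖x - y‖ / L * M + ω ‖x - y‖ := by
        rw [e1]
        refine (norm_add_le _ _).trans ?_
        rw [norm_smul, norm_smul, Real.norm_eq_abs, Real.norm_eq_abs]
        gcongr
        · exact hθlip x y
        · exact hf₁diam p hpD c hcD
        · exact (mul_le_mul_of_nonneg_left (hqM p hpD) (abs_nonneg _)).trans (hφmod x y)
      have h2 : ‖x - y‖ / L * M ≤ l * ω ‖x - y‖ := by
        have h3 := hconc.mul_map_le_mul_map h0 (norm_nonneg (x - y)) hxy.le hT
        rw [hL, div_div_eq_mul_div, div_mul_eq_mul_div, div_le_iff₀ hT]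
        nlinarith
      have h4 : 0 ≤ ‖x - y‖ / L * M := by positivity
      nlinarith
    · have hboth : s + L ≤ ‖x - y₀‖ ∧ s + L ≤ ‖y - y₀‖ := by
        rw [not_and_or, not_le, not_le] at hfar
        rcases hfar with h | h
        · exact ⟨hsep x x h (by simpa using hT), hsep x y h hxy⟩
        · exact ⟨hsep y x h (by rwa [norm_sub_rev]), hsep y y h (by simpa using hT)⟩
      rw [hHfar x hboth.1, hHfar y hboth.2]
      nlinarith [hf₁mod x y, mul_nonneg (sq_nonneg l) hω0]
  refine ⟨fun x ↦ c + (1 - l) • (H x - c), fun x y ↦ ?_, y₀, y₀ + s • e, ?_, ?_, fun x hx ↦ ?_⟩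
  · rw [add_sub_add_left_eq_sub, ← smul_sub, sub_sub_sub_cancel_right, norm_smul,
      Real.norm_of_nonneg hl1]
    exact hHmod x y
  · rw [sub_add_cancel_left, norm_neg, norm_smul, he, mul_one, Real.norm_of_nonneg hs.le]
  · have hz : ‖y₀ + s • e - y₀‖ = s := by
      rw [add_sub_cancel_left, norm_smul, he, mul_one, Real.norm_of_nonneg hs.le]
    have hzx : B ≤ ‖y₀ + s • e - x₀‖ := by
      have h1 := norm_sub_le (y₀ + s • e - x₀) (y₀ + s • e - y₀)
      rw [sub_sub_sub_cancel_left, hy₀x₀, hz] at h1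
      linarith
    have hφy : φ y₀ = ω s / M := by simp [hφ, h0, min_eq_left hs.le]
    have e1 : H y₀ - H (y₀ + s • e) = (ω s / M) • (q - p) := by
      simp only [hH, hf₁far _ hzx, hf₁far y₀ (by linarith), hθin _ hz.le,
        hθin y₀ (by simpa using hs.le), hφout _ hz.ge, hφy]
      module
    rw [add_sub_add_left_eq_sub, ← smul_sub, sub_sub_sub_cancel_right, e1, norm_smul, norm_smul,
      Real.norm_of_nonneg hl1, Real.norm_of_nonneg (by positivity)]
    calc (1 - μ / 2) * ω s ≤ ((1 - l) * (1 - l)) * ω s := by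
          gcongr
          nlinarith [sq_nonneg l]
      _ = (1 - l) * (ω s / M * ((1 - l) * M)) := by field_simp
      _ ≤ (1 - l) * (ω s / M * ‖q - p‖) := by gcongr
  · have hxy : s + L ≤ ‖x - y₀‖ := by
      have h1 := norm_sub_le (x - x₀) (x - y₀)
      rw [sub_sub_sub_cancel_left, hy₀x₀] at h1
      linarith
    simp only [hHfar x hxy, hf₁near x hx]
    have e1 : f x - (c + (1 - l) • (f x - c)) = l • (f x - c) := by module
    rw [e1, norm_smul, Real.norm_of_nonneg hl0.le]
    refine le_trans ?_ hlε
    gcongr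
    exact (hf x x₀).trans (hmono (norm_nonneg _) hR.le hx)
end

section
/- Let X be a metric space, let ω : [0,∞) → [0,∞) be continuous, subadditive, nondecreasing, not identically zero, with ω(0) = 0, and let f : X → X satisfy dist(f x, f y) ≤ ω(dist x y) for all x, y. Suppose that for every s > 0 there exists μ ∈ (0,1) such that dist(f x, f y) ≤ μ·ω(dist x y) for all x, y ∈ X with dist x y ≥ s. Then for every s > 0 one has sup{dist(f x, f y) : dist x y ≤ s} < ω(s). -/
open Set

/-- A nonnegative, subadditive, nondecreasing function on `[0, ∞)` that is nonzero at some positive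
point is positive at every positive point. -/
lemma pos_of_subadditive_of_monotoneOn {ω : ℝ → ℝ} (hnonneg : ∀ s, 0 ≤ s → 0 ≤ ω s)
    (hsub : ∀ a b : ℝ, 0 ≤ a → 0 ≤ b → ω (a + b) ≤ ω a + ω b)
    (hmono : MonotoneOn ω (Ici 0)) (h0 : ω 0 = 0) (hne : ∃ s, 0 < s ∧ ω s ≠ 0)
    {s : ℝ} (hs : 0 < s) : 0 < ω s := by
  refine lt_of_le_of_ne (hnonneg s hs.le) fun hzero => ?_
  obtain ⟨t, ht, hωt⟩ := hne
  have hmul (n : ℕ) : ω (n * s) ≤ 0 := by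
    induction n with
    | zero => simp [h0]
    | succ n ih =>
      have h := hsub (n * s) s (by positivity) hs.le
      push_cast
      rw [add_one_mul]
      linarith
  obtain ⟨n, hn⟩ := exists_nat_ge (t / s)
  have hle : t ≤ n * s := (div_le_iff₀ hs).1 hn
  exact hωt (le_antisymm ((hmono ht.le (ht.le.trans hle) hle).trans (hmul n)) (hnonneg t ht.le))

/-- Concluding deduction of the σ-porosity theorem: if `f ∈ 𝒞_ω(X)` is, for every scale
`s > 0`, a Rakotch-type contraction at distances `≥ s`, then its modulus of continuity is
strictly below `ω` at every positive scale. -/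
theorem stmt_4 {X : Type*} [MetricSpace X]
    (ω : ℝ → ℝ) (hnonneg : ∀ s, 0 ≤ s → 0 ≤ ω s)
    (hcont : ContinuousOn ω (Ici 0))
    (hsub : ∀ a b : ℝ, 0 ≤ a → 0 ≤ b → ω (a + b) ≤ ω a + ω b)
    (hmono : MonotoneOn ω (Ici 0)) (h0 : ω 0 = 0)
    (hne : ∃ s, 0 < s ∧ ω s ≠ 0)
    (f : X → X) (hf : ∀ x y : X, dist (f x) (f y) ≤ ω (dist x y))
    (hR : ∀ s : ℝ, 0 < s → ∃ μ : ℝ, μ ∈ Ioo (0 : ℝ) 1 ∧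
      ∀ x y : X, s ≤ dist x y → dist (f x) (f y) ≤ μ * ω (dist x y)) :
    ∀ s : ℝ, 0 < s →
      sSup {d : ℝ | ∃ x y : X, dist x y ≤ s ∧ d = dist (f x) (f y)} < ω s := by
  intro s hs
  have hpos : 0 < ω s := pos_of_subadditive_of_monotoneOn hnonneg hsub hmono h0 hne hs
  obtain ⟨δ, hδ, hsmall⟩ := Metric.continuousWithinAt_iff.1 (hcont 0 self_mem_Ici)
    (ω s / 2) (half_pos hpos)
  obtain ⟨μ, ⟨hμ0, hμ1⟩, hμ⟩ := hR δ hδ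
  have hbound : sSup {d : ℝ | ∃ x y : X, dist x y ≤ s ∧ d = dist (f x) (f y)}
      ≤ max (ω s / 2) (μ * ω s) := by
    refine Real.sSup_le ?_ (le_max_of_le_left (half_pos hpos).le)
    rintro _ ⟨x, y, hxy, rfl⟩
    rcases lt_or_ge (dist x y) δ with hlt | hge
    · have h := hsmall (x := dist x y) dist_nonneg (by simpa using hlt)
      rw [h0, Real.dist_0_eq_abs] at h
      exact le_max_of_le_left ((hf x y).trans ((le_abs_self _).trans h.le))
    · exact le_max_of_le_right ((hμ x y hge).trans
        (mul_le_mul_of_nonneg_left (hmono dist_nonneg hs.le hxy) hμ0.le))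
  exact hbound.trans_lt (max_lt (half_lt_self hpos) (mul_lt_of_lt_one_left hpos hμ1))
end

section
/- Let E be a nontrivial separable real Banach space and let ω : [0,∞) → [0,∞) be concave, nondecreasing, not identically zero, with ω(0) = 0. Endow 𝒞_ω(E) with the topology of pointwise convergence (the subspace topology from E → E with the product topology). Then there is a meagre set ℳ ⊂ 𝒞_ω(E) such that every f ∈ 𝒞_ω(E) \ ℳ satisfies ω_f(s) = ω(s) for every s ≥ 0. -/
open Set

section ConcaveModulus

variable {ω : ℝ → ℝ}

theorem ConcaveOn.mul_le_apply_mul (hconc : ConcaveOn ℝ (Ici 0) ω) (h0 : ω 0 = 0)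
    {c t : ℝ} (hc0 : 0 ≤ c) (hc1 : c ≤ 1) (ht : 0 ≤ t) : c * ω t ≤ ω (c * t) := by
  have h := hconc.2 (mem_Ici.2 ht) (mem_Ici.2 le_rfl) hc0 (sub_nonneg.2 hc1) (by ring)
  simpa [h0] using h

theorem ConcaveOn.apply_mul_le (hconc : ConcaveOn ℝ (Ici 0) ω) (h0 : ω 0 = 0)
    {c t : ℝ} (hc : 1 ≤ c) (ht : 0 ≤ t) : ω (c * t) ≤ c * ω t := by
  have hc0 : 0 < c := by linarith
  have h := hconc.mul_le_apply_mul h0 (inv_nonneg.2 hc0.le) (inv_le_one_of_one_le₀ hc)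
    (mul_nonneg hc0.le ht)
  rw [inv_mul_cancel_left₀ hc0.ne'] at h
  rwa [inv_mul_le_iff₀ hc0] at h

theorem ConcaveOn.apply_add_le (hconc : ConcaveOn ℝ (Ici 0) ω) (h0 : ω 0 = 0)
    {a b : ℝ} (ha : 0 ≤ a) (hb : 0 ≤ b) : ω (a + b) ≤ ω a + ω b := by
  rcases (add_nonneg ha hb).eq_or_lt' with hab | hab
  · have ha' : a = 0 := by linarith
    have hb' : b = 0 := by linarith
    simp [ha', hb', h0]
  have h1 := hconc.mul_le_apply_mul h0 (div_nonneg ha hab.le)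
    ((div_le_one hab).2 (by linarith)) hab.le
  have h2 := hconc.mul_le_apply_mul h0 (div_nonneg hb hab.le)
    ((div_le_one hab).2 (by linarith)) hab.le
  rw [div_mul_cancel₀ _ hab.ne'] at h1 h2
  have h3 : a / (a + b) * ω (a + b) + b / (a + b) * ω (a + b) = ω (a + b) := by
    field_simp
  linarith

theorem ConcaveOn.abs_apply_sub_apply_le (hconc : ConcaveOn ℝ (Ici 0) ω)
    (hmono : MonotoneOn ω (Ici 0)) (h0 : ω 0 = 0) {a b d : ℝ} (ha : 0 ≤ a) (hb : 0 ≤ b)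
    (hd : |a - b| ≤ d) : |ω a - ω b| ≤ ω d := by
  have hd0 : 0 ≤ d := (abs_nonneg _).trans hd
  rw [abs_le] at hd
  have key : ∀ x y : ℝ, 0 ≤ x → 0 ≤ y → x ≤ y + d → ω x ≤ ω y + ω d := fun x y hx hy hxy =>
    (hmono hx (mem_Ici.2 (by positivity)) hxy).trans (hconc.apply_add_le h0 hy hd0)
  rw [abs_le]
  constructor
  · linarith [key b a hb ha (by linarith)]
  · linarith [key a b ha hb (by linarith)]

end ConcaveModulus

section LogCutoff

/-- A cutoff equal to `1` on `[0, R]` that decreases logarithmically to `0` at speed `ε`. -/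
noncomputable def logCutoff (ε R t : ℝ) : ℝ := max 0 (min 1 (1 - ε * Real.log (t / R)))

theorem logCutoff_nonneg (ε R t : ℝ) : 0 ≤ logCutoff ε R t := le_max_left _ _

theorem logCutoff_le_one (ε R t : ℝ) : logCutoff ε R t ≤ 1 :=
  max_le zero_le_one (min_le_left _ _)

theorem logCutoff_eq_one {ε R t : ℝ} (hε : 0 ≤ ε) (ht : 0 ≤ t) (htR : t ≤ R) :
    logCutoff ε R t = 1 := by
  have hlog : Real.log (t / R) ≤ 0 :=
    Real.log_nonpos (div_nonneg ht (ht.trans htR)) (div_le_one_of_le₀ htR (ht.trans htR))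
  have : 1 ≤ 1 - ε * Real.log (t / R) := by nlinarith
  rw [logCutoff, min_eq_left this, max_eq_right zero_le_one]

theorem logCutoff_eq_zero {ε R t : ℝ} (hε : 0 < ε) (hR : 0 < R)
    (ht : R * Real.exp (1 / ε) ≤ t) : logCutoff ε R t = 0 := by
  have hlog : 1 / ε ≤ Real.log (t / R) := by
    rw [Real.le_log_iff_exp_le
      (div_pos ((mul_pos hR (Real.exp_pos _)).trans_le ht) hR), le_div_iff₀ hR]
    linarith
  rw [div_le_iff₀' hε] at hlog
  exact max_eq_left ((min_le_right _ _).trans (by linarith))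

theorem mul_abs_logCutoff_sub_le {ε R a b : ℝ} (hε : 0 ≤ ε) (hR : 0 < R) (ha : 0 ≤ a)
    (hab : a ≤ b) : a * |logCutoff ε R a - logCutoff ε R b| ≤ ε * (b - a) := by
  rcases ha.eq_or_lt' with rfl | ha
  · simpa using mul_nonneg hε hab
  have hb : 0 < b := ha.trans_le hab
  have h1 : |logCutoff ε R a - logCutoff ε R b| ≤
      |(1 - ε * Real.log (a / R)) - (1 - ε * Real.log (b / R))| := by
    have hmax := abs_max_sub_max_le_abs (min 1 (1 - ε * Real.log (a / R)))
      (min 1 (1 - ε * Real.log (b / R))) 0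
    have hmin := abs_min_sub_min_le_max 1 (1 - ε * Real.log (a / R)) 1
      (1 - ε * Real.log (b / R))
    rw [sub_self, abs_zero, max_eq_right (abs_nonneg _)] at hmin
    rw [logCutoff, logCutoff, max_comm 0, max_comm 0]
    exact hmax.trans hmin
  have h2 : (1 - ε * Real.log (a / R)) - (1 - ε * Real.log (b / R)) =
      ε * Real.log (b / a) := by
    rw [Real.log_div ha.ne' hR.ne', Real.log_div hb.ne' hR.ne', Real.log_div hb.ne' ha.ne']
    ring
  have h3 : 0 ≤ Real.log (b / a) := Real.log_nonneg ((one_le_div ha).2 hab)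
  rw [h2, abs_of_nonneg (mul_nonneg hε h3)] at h1
  have h4 : Real.log (b / a) ≤ b / a - 1 := Real.log_le_sub_one_of_pos (div_pos hb ha)
  calc a * |logCutoff ε R a - logCutoff ε R b| ≤ a * (ε * (b / a - 1)) := by
        gcongr
        exact h1.trans (by gcongr)
    _ = ε * (b - a) := by field_simp

end LogCutoff

section NormedSpace

variable {E : Type*} [NormedAddCommGroup E] [NormedSpace ℝ E]

/-- A map that fixes a given ball, collapses the exterior of a larger ball to the centre,
and is almost nonexpansive. -/
theorem exists_almost_nonexpansive_collapse (x₀ : E) {ε R : ℝ} (hε : 0 < ε) (hR : 0 < R) :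
    ∃ (ρ : E → E) (R' : ℝ), 0 ≤ R' ∧ (∀ x, ‖x - x₀‖ ≤ R → ρ x = x) ∧
      (∀ x, R' ≤ ‖x - x₀‖ → ρ x = x₀) ∧ (∀ x, ‖ρ x - x₀‖ ≤ R') ∧
      ∀ x y, ‖ρ x - ρ y‖ ≤ (1 + ε) * ‖x - y‖ := by
  have hR' : 0 ≤ R * Real.exp (1 / ε) := (mul_pos hR (Real.exp_pos _)).le
  refine ⟨fun x => x₀ + logCutoff ε R ‖x - x₀‖ • (x - x₀), R * Real.exp (1 / ε), hR',
    fun x hx => ?_, fun x hx => ?_, fun x => ?_, ?_⟩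
  · simp [logCutoff_eq_one hε.le (norm_nonneg _) hx]
  · simp [logCutoff_eq_zero hε hR hx]
  · rw [add_sub_cancel_left, norm_smul, Real.norm_of_nonneg (logCutoff_nonneg _ _ _)]
    rcases le_total (R * Real.exp (1 / ε)) ‖x - x₀‖ with h | h
    · simpa [logCutoff_eq_zero hε hR h] using hR'
    · exact (mul_le_of_le_one_left (norm_nonneg _) (logCutoff_le_one _ _ _)).trans h
  · have key : ∀ x y : E, ‖x - x₀‖ ≤ ‖y - x₀‖ →
        ‖(x₀ + logCutoff ε R ‖x - x₀‖ • (x - x₀)) - (x₀ + logCutoff ε R ‖y - x₀‖ • (y - x₀))‖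
          ≤ (1 + ε) * ‖x - y‖ := by
      intro x y hxy
      have hdecomp : (x₀ + logCutoff ε R ‖x - x₀‖ • (x - x₀)) -
          (x₀ + logCutoff ε R ‖y - x₀‖ • (y - x₀)) = logCutoff ε R ‖y - x₀‖ • (x - y) +
            (logCutoff ε R ‖x - x₀‖ - logCutoff ε R ‖y - x₀‖) • (x - x₀) := by
        module
      have h1 := mul_abs_logCutoff_sub_le hε.le hR (norm_nonneg (x - x₀)) hxy
      have h2 : ‖y - x₀‖ - ‖x - x₀‖ ≤ ‖x - y‖ := by
        have := norm_sub_norm_le (y - x₀) (x - x₀)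
        rwa [sub_sub_sub_cancel_right, norm_sub_rev y x] at this
      have h3 := mul_le_mul_of_nonneg_left h2 hε.le
      have h4 := mul_le_of_le_one_left (norm_nonneg (x - y)) (logCutoff_le_one ε R ‖y - x₀‖)
      rw [hdecomp]
      refine (norm_add_le _ _).trans ?_
      rw [norm_smul, norm_smul, Real.norm_of_nonneg (logCutoff_nonneg _ _ _), Real.norm_eq_abs]
      linarith
    intro x y
    rcases le_total ‖x - x₀‖ ‖y - x₀‖ with h | h
    · exact key x y h
    · rw [norm_sub_rev, norm_sub_rev x y]
      exact key y x h

theorem norm_sub_add_smul_le {a v z : E} {M t : ℝ} (ht0 : 0 ≤ t) (ht1 : t ≤ 1)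
    (h₁ : ‖z - a‖ ≤ M) (h₂ : ‖z - (a + v)‖ ≤ M) : ‖z - (a + t • v)‖ ≤ M := by
  have hdecomp : z - (a + t • v) = (1 - t) • (z - a) + t • (z - (a + v)) := by module
  rw [hdecomp]
  refine (norm_add_le _ _).trans ?_
  rw [norm_smul, norm_smul, Real.norm_of_nonneg ht0, Real.norm_of_nonneg (sub_nonneg.2 ht1)]
  nlinarith

variable {ω : ℝ → ℝ}

/-- A map that is constant far away can be modified there so as to oscillate by a prescribed
vector at scale `s`. -/
theorem exists_far_bump [Nontrivial E]
    (hconc : ConcaveOn ℝ (Ici 0) ω) (hmono : MonotoneOn ω (Ici 0)) (h0 : ω 0 = 0)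
    {g : E → E} (hg : ∀ x y, ‖g x - g y‖ ≤ ω ‖x - y‖) {x₀ a v : E} {R s M D : ℝ}
    (hR : 0 ≤ R) (hga : ∀ x, R ≤ ‖x - x₀‖ → g x = a) (hs : 0 < s) (hωs : 0 < ω s)
    (hv : ‖v‖ ≤ ω s) (hM₁ : ∀ x, ‖g x - a‖ ≤ M) (hM₂ : ∀ x, ‖g x - (a + v)‖ ≤ M)
    (hD : 0 ≤ D) (hMD : M ≤ ω D) :
    ∃ k : E → E, (∀ x y, ‖k x - k y‖ ≤ ω ‖x - y‖) ∧ (∀ x, ‖x - x₀‖ ≤ R → k x = g x) ∧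
      ∃ x y, ‖x - y‖ ≤ s ∧ ‖k x - k y‖ = ‖v‖ := by
  obtain ⟨e, he⟩ := exists_norm_eq E zero_le_one
  set p : E := x₀ + (R + D + s) • e with hp
  have hpx : ‖p - x₀‖ = R + D + s := by
    rw [hp, add_sub_cancel_left, norm_smul, he, mul_one, Real.norm_of_nonneg (by positivity)]
  set τ : E → ℝ := fun x => max 0 (1 - ω ‖x - p‖ / ω s) with hτ
  have hτ0 : ∀ x, 0 ≤ τ x := fun x => le_max_left _ _
  have hω0 : ∀ t, 0 ≤ t → 0 ≤ ω t := fun t ht => h0 ▸ hmono self_mem_Ici ht ht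
  have hτ1 : ∀ x, τ x ≤ 1 := fun x => max_le zero_le_one
    (sub_le_self _ (div_nonneg (hω0 _ (norm_nonneg _)) hωs.le))
  have hτs : ∀ x, s ≤ ‖x - p‖ → τ x = 0 := fun x hx => by
    refine max_eq_left (sub_nonpos.2 ((one_le_div hωs).2 (hmono hs.le (norm_nonneg _) hx)))
  have hτω : ∀ x y, |τ x - τ y| * ω s ≤ ω ‖x - y‖ := fun x y => by
    have h1 : |τ x - τ y| ≤ |(1 - ω ‖x - p‖ / ω s) - (1 - ω ‖y - p‖ / ω s)| := by
      simp only [hτ, max_comm (0 : ℝ)]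
      exact abs_max_sub_max_le_abs _ _ _
    have h2 : (1 - ω ‖x - p‖ / ω s) - (1 - ω ‖y - p‖ / ω s) =
        (ω ‖y - p‖ - ω ‖x - p‖) / ω s := by ring
    rw [h2, abs_div, abs_of_pos hωs, le_div_iff₀ hωs, abs_sub_comm (ω ‖y - p‖)] at h1
    refine h1.trans (hconc.abs_apply_sub_apply_le hmono h0 (norm_nonneg _) (norm_nonneg _) ?_)
    simpa using abs_norm_sub_norm_le (x - p) (y - p)
  have key : ∀ x y, g x ≠ a → ‖(g x + τ x • v) - (g y + τ y • v)‖ ≤ ω ‖x - y‖ := by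
    intro x y hx
    have hxR : ‖x - x₀‖ < R := lt_of_not_ge fun h => hx (hga x h)
    have hxp : D + s ≤ ‖x - p‖ := by
      have := norm_sub_le_norm_sub_add_norm_sub p x x₀
      rw [norm_sub_rev p x] at this
      linarith
    rw [hτs x (by linarith), zero_smul, add_zero]
    by_cases hy : s ≤ ‖y - p‖
    · rw [hτs y hy, zero_smul, add_zero]
      exact hg x y
    have hxy : D ≤ ‖x - y‖ := by
      have := norm_sub_le_norm_sub_add_norm_sub x y p
      linarith
    have hya : g y = a := hga y (by
      have := norm_sub_le_norm_sub_add_norm_sub p y x₀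
      rw [norm_sub_rev p y] at this
      linarith)
    rw [hya]
    exact (norm_sub_add_smul_le (hτ0 y) (hτ1 y) (hM₁ x) (hM₂ x)).trans
      (hMD.trans (hmono hD (norm_nonneg _) hxy))
  refine ⟨fun x => g x + τ x • v, fun x y => ?_, fun x hx => ?_, p, p + s • e, ?_, ?_⟩
  · by_cases hx : g x = a
    · by_cases hy : g y = a
      · have : (g x + τ x • v) - (g y + τ y • v) = (τ x - τ y) • v := by
          rw [hx, hy]
          module
        rw [this, norm_smul, Real.norm_eq_abs]
        exact (mul_le_mul_of_nonneg_left hv (abs_nonneg _)).trans (hτω x y)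
      · rw [norm_sub_rev, norm_sub_rev x y]
        exact key y x hy
    · exact key x y hx
  · have : s ≤ ‖x - p‖ := by
      have := norm_sub_le_norm_sub_add_norm_sub p x x₀
      rw [norm_sub_rev p x] at this
      linarith
    simp [hτs x this]
  · simp [norm_smul, he, abs_of_pos hs]
  · have h1 : τ p = 1 := by simp [hτ, h0]
    have hse : ‖p + s • e - p‖ = s := by simp [norm_smul, he, abs_of_pos hs]
    have h2 : τ (p + s • e) = 0 := hτs _ hse.ge
    have h3 : g p = a := hga p (by linarith)
    have h4 : g (p + s • e) = a := hga _ (by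
      have := norm_sub_le_norm_sub_add_norm_sub p (p + s • e) x₀
      rw [norm_sub_rev p (p + s • e)] at this
      linarith)
    simp [h1, h2, h3, h4]

/-- If `‖f x - f y‖ ≤ K < L` always, then there is a point of the range of `f` and a vector of
norm almost `L` at it whose endpoint stays within distance less than `L` of the whole range. -/
theorem exists_vector_near_range [Nontrivial E] {f : E → E} {K L η : ℝ}
    (hKL : K < L) (hη : 0 < η) (hf : ∀ x y, ‖f x - f y‖ ≤ K) :
    ∃ (x₀ v : E) (M : ℝ), M < L ∧ K ≤ M ∧ L - η ≤ ‖v‖ ∧ ∀ x, ‖f x - (f x₀ + v)‖ ≤ M := by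
  obtain ⟨e, he⟩ := exists_norm_eq E zero_le_one
  set M := max K (L - η / 2) with hM
  have hKM : K ≤ M := le_max_left _ _
  have hLM : L - η / 2 ≤ M := le_max_right _ _
  set S : Set ℝ := {θ | ∀ x, ‖f x - (f 0 + θ • e)‖ ≤ M} with hS
  have h0S : (0 : ℝ) ∈ S := fun x => by simpa using (hf x 0).trans hKM
  have hbdd : BddAbove S := ⟨M, fun θ hθ => by
    have := hθ 0
    rw [sub_add_cancel_left, norm_neg, norm_smul, he, mul_one] at this
    exact (le_abs_self θ).trans this⟩
  obtain ⟨θ, hθS, hθ⟩ := exists_lt_of_lt_csSup ⟨0, h0S⟩ (sub_lt_self (sSup S) (half_pos hη))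
  have hθ' : θ + η / 2 ∉ S := fun h => by linarith [le_csSup hbdd h]
  simp only [hS, mem_ofPred_eq, not_forall, not_le] at hθ'
  obtain ⟨x₀, hx₀⟩ := hθ'
  refine ⟨x₀, f 0 + θ • e - f x₀, M, max_lt hKL (by linarith), hKM, ?_, fun x => ?_⟩
  · have h1 : f x₀ - (f 0 + (θ + η / 2) • e) = -((f 0 + θ • e - f x₀) + (η / 2) • e) := by
      module
    rw [h1, norm_neg] at hx₀
    have h2 := norm_add_le (f 0 + θ • e - f x₀) ((η / 2) • e)
    rw [norm_smul, he, mul_one, Real.norm_of_nonneg (half_pos hη).le] at h2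
    linarith
  · rw [add_sub_cancel]
    exact hθS x

/-- A map whose modulus is strictly below `ω` can be modified outside any ball so as to
nearly attain `ω s`. -/
theorem exists_modification_outside_ball [Nontrivial E]
    (hconc : ConcaveOn ℝ (Ici 0) ω) (hmono : MonotoneOn ω (Ici 0)) (h0 : ω 0 = 0)
    {f : E → E} (hf : ∀ x y, ‖f x - f y‖ ≤ ω ‖x - y‖) {c s η : ℝ} (hc0 : 0 < c)
    (hc1 : c < 1) (hs : 0 < s) (hωs : 0 < ω s) (hη : 0 < η) (r : ℝ) :
    ∃ k : E → E, (∀ x y, ‖k x - k y‖ ≤ ω ‖x - y‖) ∧ (∀ x, ‖x‖ ≤ r → k x = c • f x) ∧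
      ∃ x y, ‖x - y‖ ≤ s ∧ ω s - η < ‖k x - k y‖ := by
  have hcf : ∀ x y, ‖c • f x - c • f y‖ ≤ c * ω ‖x - y‖ := fun x y => by
    rw [← smul_sub, norm_smul, Real.norm_of_nonneg hc0.le]
    exact mul_le_mul_of_nonneg_left (hf x y) hc0.le
  -- It suffices to find a suitable centre and a suitable vector.
  suffices H : ∃ x₀ v : E, ‖v‖ ≤ ω s ∧ ω s - η < ‖v‖ ∧
      ∀ R, ∃ M D, 0 ≤ D ∧ M ≤ ω D ∧ ∀ x, ‖x - x₀‖ ≤ R → ‖c • f x - c • f x₀‖ ≤ M ∧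
        ‖c • f x - (c • f x₀ + v)‖ ≤ M by
    obtain ⟨x₀, v, hv, hvη, H⟩ := H
    have hε : 0 < 1 / c - 1 := sub_pos.2 ((one_lt_div hc0).2 hc1)
    obtain ⟨ρ, R, hR0, hρid, hρout, hρR, hρlip⟩ :=
      exists_almost_nonexpansive_collapse x₀ hε (R := max r 0 + ‖x₀‖ + 1) (by positivity)
    obtain ⟨M, D, hD, hMD, hM⟩ := H (max R (max r 0 + ‖x₀‖ + 1))
    have hgω : ∀ x y, ‖c • f (ρ x) - c • f (ρ y)‖ ≤ ω ‖x - y‖ := fun x y => by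
      have h1 : ω ‖ρ x - ρ y‖ ≤ 1 / c * ω ‖x - y‖ := by
        refine (hmono (norm_nonneg _) (mem_Ici.2 ?_) (hρlip x y)).trans ?_
        · exact mul_nonneg (by linarith) (norm_nonneg _)
        · rw [add_sub_cancel]
          exact hconc.apply_mul_le h0 (by linarith) (norm_nonneg _)
      calc ‖c • f (ρ x) - c • f (ρ y)‖ ≤ c * ω ‖ρ x - ρ y‖ := hcf _ _
        _ ≤ c * (1 / c * ω ‖x - y‖) := by gcongr
        _ = ω ‖x - y‖ := by field_simp
    obtain ⟨k, hk, hkg, x, y, hxy, hkv⟩ := exists_far_bump hconc hmono h0 hgω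
      (R := max R (max r 0 + ‖x₀‖ + 1)) (hR0.trans (le_max_left _ _)) (a := c • f x₀)
      (fun x hx => by rw [hρout x ((le_max_left _ _).trans hx)]) hs hωs hv
      (fun x => (hM _ ((hρR x).trans (le_max_left _ _))).1)
      (fun x => (hM _ ((hρR x).trans (le_max_left _ _))).2) hD hMD
    refine ⟨k, hk, fun x hx => ?_, x, y, hxy, hkv ▸ hvη⟩
    have hx₀ : ‖x - x₀‖ ≤ max r 0 + ‖x₀‖ + 1 := by
      linarith [norm_sub_le x x₀, le_max_left r 0]
    rw [hkg x (hx₀.trans (le_max_right _ _)), hρid x hx₀]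
  by_cases hbdd : BddAbove (ω '' Ici 0)
  · set L := sSup (ω '' Ici 0) with hL
    have hωL : ∀ t, 0 ≤ t → ω t ≤ L := fun t ht => le_csSup hbdd (mem_image_of_mem ω ht)
    have hLpos : 0 < L := hωs.trans_le (hωL s hs.le)
    have hcfL : ∀ x y, ‖c • f x - c • f y‖ ≤ c * L := fun x y =>
      (hcf x y).trans (mul_le_mul_of_nonneg_left (hωL _ (norm_nonneg _)) hc0.le)
    obtain ⟨x₀, v, M, hML, hKM, hv, hM⟩ := exists_vector_near_range (η := η / 2)
      (mul_lt_of_lt_one_left hLpos hc1) (half_pos hη) hcfL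
    obtain ⟨_, ⟨D, hD, rfl⟩, hMD⟩ := exists_lt_of_lt_csSup ⟨_, mem_image_of_mem ω hs.le⟩ hML
    obtain ⟨t, ht0, ht1, htv, htη⟩ : ∃ t : ℝ, 0 ≤ t ∧ t ≤ 1 ∧ t * ‖v‖ ≤ ω s ∧
        ω s - η < t * ‖v‖ := by
      rcases le_total ‖v‖ (ω s) with h | h
      · exact ⟨1, zero_le_one, le_rfl, by linarith, by linarith [hωL s hs.le]⟩
      · have hv0 : 0 < ‖v‖ := hωs.trans_le h
        have := div_mul_cancel₀ (ω s) hv0.ne'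
        exact ⟨ω s / ‖v‖, by positivity, (div_le_one hv0).2 h, this.le, by linarith⟩
    have hnorm : ‖t • v‖ = t * ‖v‖ := by rw [norm_smul, Real.norm_of_nonneg ht0]
    refine ⟨x₀, t • v, hnorm ▸ htv, hnorm ▸ htη, fun R => ⟨M, D, hD, hMD.le, fun x _ => ?_⟩⟩
    have h1 := (hcfL x x₀).trans hKM
    exact ⟨h1, norm_sub_add_smul_le ht0 ht1 h1 (hM x)⟩
  · obtain ⟨v, hv⟩ := exists_norm_eq E hωs.le
    refine ⟨0, v, hv.le, by linarith, fun R => ?_⟩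
    obtain ⟨_, ⟨D, hD, rfl⟩, hMD⟩ := not_bddAbove_iff.1 hbdd (c * ω (max R 0) + ω s)
    refine ⟨c * ω (max R 0) + ω s, D, hD, hMD.le, fun x hx => ?_⟩
    have h1 : ‖c • f x - c • f 0‖ ≤ c * ω (max R 0) :=
      (hcf x 0).trans (mul_le_mul_of_nonneg_left
        (hmono (norm_nonneg _) (mem_Ici.2 (le_max_right _ _)) (hx.trans (le_max_left _ _))) hc0.le)
    refine ⟨by linarith, ?_⟩
    rw [← sub_sub]
    exact (norm_sub_le _ _).trans (by linarith)

open Filter Topology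

theorem dense_setOf_almost_attaining [Nontrivial E]
    (hconc : ConcaveOn ℝ (Ici 0) ω) (hmono : MonotoneOn ω (Ici 0)) (h0 : ω 0 = 0)
    {s η : ℝ} (hs : 0 < s) (hη : 0 < η) :
    Dense {f : {f : E → E // ∀ x y : E, ‖f x - f y‖ ≤ ω ‖x - y‖} |
      ∃ x y, ‖x - y‖ ≤ s ∧ ω s - η < ‖f.1 x - f.1 y‖} := by
  intro f
  have hω0 : ∀ t, 0 ≤ t → 0 ≤ ω t := fun t ht => h0 ▸ hmono self_mem_Ici ht ht
  rcases (hω0 s hs.le).eq_or_lt' with hωs | hωs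
  · exact subset_closure ⟨0, 0, by simpa using hs.le, by simpa [hωs] using hη⟩
  set c : ℕ → ℝ := fun n => 1 - 1 / ((n : ℝ) + 2) with hc
  have hc0 : ∀ n, 0 < c n := fun n => by
    have : (1 : ℝ) / ((n : ℝ) + 2) < 1 := (div_lt_one (by positivity)).2 (by
      linarith [n.cast_nonneg (α := ℝ)])
    simpa [hc] using this
  have hc1 : ∀ n, c n < 1 := fun n => sub_lt_self _ (by positivity)
  have hclim : Tendsto c atTop (𝓝 1) := by
    have h := (tendsto_one_div_add_atTop_nhds_zero_nat (𝕜 := ℝ)).comp (tendsto_add_atTop_nat 1)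
    have h' := h.const_sub 1
    rw [sub_zero] at h'
    refine h'.congr fun n => ?_
    simp only [hc, Function.comp_apply]
    push_cast
    ring
  choose k hk hkf hkU using fun n : ℕ =>
    exists_modification_outside_ball hconc hmono h0 f.2 (hc0 n) (hc1 n) hs hωs hη n
  refine mem_closure_of_tendsto (f := fun n => ⟨k n, hk n⟩) (b := atTop) ?_
    (Eventually.of_forall hkU)
  rw [tendsto_subtype_rng, tendsto_pi_nhds]
  intro x
  have h1 : Tendsto (fun n => c n • f.1 x) atTop (𝓝 (f.1 x)) := by
    simpa using hclim.smul_const (f.1 x)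
  refine h1.congr' ?_
  obtain ⟨N, hN⟩ := exists_nat_ge ‖x‖
  filter_upwards [eventually_ge_atTop N] with n hn
  exact (hkf n x (hN.trans (by exact_mod_cast hn))).symm

end NormedSpace

theorem isOpen_setOf_almost_attaining {E : Type*} [NormedAddCommGroup E] {ω : ℝ → ℝ} (s d : ℝ) :
    IsOpen {f : {f : E → E // ∀ x y : E, ‖f x - f y‖ ≤ ω ‖x - y‖} |
      ∃ x y, ‖x - y‖ ≤ s ∧ d < ‖f.1 x - f.1 y‖} := by
  simp only [ofPred_exists]
  refine isOpen_iUnion fun x => isOpen_iUnion fun y => isOpen_const.and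
    (isOpen_lt continuous_const ?_)
  exact (((continuous_apply x).comp continuous_subtype_val).sub
    ((continuous_apply y).comp continuous_subtype_val)).norm

/-- Theorem on pointwise convergence (normed-space instance): if `E` is a nontrivial
separable real Banach space and `ω` is concave, nondecreasing, nonzero with `ω 0 = 0`,
then in `𝒞_ω(E)` with the topology of pointwise convergence there is a meagre set `ℳ`
outside of which every map has modulus of continuity exactly `ω`. -/
theorem stmt_5 {E : Type*} [NormedAddCommGroup E] [NormedSpace ℝ E]
    [CompleteSpace E] [Nontrivial E] [TopologicalSpace.SeparableSpace E]
    (ω : ℝ → ℝ) (hnonneg : ∀ s, 0 ≤ s → 0 ≤ ω s)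
    (hconc : ConcaveOn ℝ (Ici 0) ω) (hmono : MonotoneOn ω (Ici 0))
    (h0 : ω 0 = 0) (hne : ∃ s, 0 < s ∧ ω s ≠ 0) :
    ∃ M : Set {f : E → E // ∀ x y : E, ‖f x - f y‖ ≤ ω ‖x - y‖},
      IsMeagre M ∧
      ∀ f : {f : E → E // ∀ x y : E, ‖f x - f y‖ ≤ ω ‖x - y‖}, f ∉ M →
        ∀ s : ℝ, 0 ≤ s →
          sSup {d : ℝ | ∃ x y : E, ‖x - y‖ ≤ s ∧ d = ‖f.1 x - f.1 y‖} = ω s := by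
  set U : {q : ℚ // 0 < q} × ℕ → Set {f : E → E // ∀ x y : E, ‖f x - f y‖ ≤ ω ‖x - y‖} :=
    fun i => {f | ∃ x y, ‖x - y‖ ≤ ((i.1 : ℚ) : ℝ) ∧
      ω ((i.1 : ℚ) : ℝ) - 1 / ((i.2 : ℝ) + 1) < ‖f.1 x - f.1 y‖} with hU
  refine ⟨⋃ i, (U i)ᶜ, isMeagre_iUnion fun i => ?_, fun f hf s hs => ?_⟩
  · rw [IsMeagre, compl_compl]
    exact residual_of_dense_open (isOpen_setOf_almost_attaining _ _)
      (dense_setOf_almost_attaining hconc hmono h0 (by exact_mod_cast i.1.2) (by positivity))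
  simp only [mem_iUnion, mem_compl_iff, not_exists, not_not] at hf
  have hub : ∀ d ∈ {d : ℝ | ∃ x y : E, ‖x - y‖ ≤ s ∧ d = ‖f.1 x - f.1 y‖}, d ≤ ω s := by
    rintro _ ⟨x, y, hxy, rfl⟩
    exact (f.2 x y).trans (hmono (norm_nonneg _) hs hxy)
  have h0mem : (0 : ℝ) ∈ {d : ℝ | ∃ x y : E, ‖x - y‖ ≤ s ∧ d = ‖f.1 x - f.1 y‖} :=
    ⟨0, 0, by simpa using hs, by simp⟩
  refine le_antisymm (csSup_le ⟨0, h0mem⟩ hub) ?_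
  rcases hs.eq_or_lt' with rfl | hs0
  · exact h0.le.trans (le_csSup ⟨_, hub⟩ h0mem)
  refine le_of_forall_pos_le_add fun η hη => ?_
  have hωs := hnonneg s hs
  obtain ⟨q, hq, hqs⟩ := exists_rat_btwn
    (max_lt hs0 (mul_lt_of_lt_one_left hs0 (sub_lt_self 1
      (show 0 < η / 2 / (ω s + 1) by positivity))))
  obtain ⟨hq0, hqη⟩ := max_lt_iff.1 hq
  have hωq : ω s - η / 2 ≤ ω q := by
    have h1 := hconc.mul_le_apply_mul h0 (div_nonneg hq0.le hs) ((div_le_one hs0).2 hqs.le) hs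
    rw [div_mul_cancel₀ _ hs0.ne'] at h1
    have h2 : 1 - η / 2 / (ω s + 1) ≤ q / s := (le_div_iff₀ hs0).2 hqη.le
    have h3 := mul_le_mul_of_nonneg_right h2 hωs
    have h4 : η / 2 / (ω s + 1) * ω s ≤ η / 2 := by
      rw [div_mul_eq_mul_div, div_le_iff₀ (by positivity)]
      nlinarith
    linarith
  obtain ⟨n, hn⟩ := exists_nat_one_div_lt (half_pos hη)
  obtain ⟨x, y, hxy, hlt⟩ := hf (⟨q, by exact_mod_cast hq0⟩, n)
  have hle : ‖f.1 x - f.1 y‖ ≤ _ := le_csSup ⟨_, hub⟩ ⟨x, y, hxy.trans hqs.le, rfl⟩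
  simp only at hlt
  linarith
end
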